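/- Suppose the twin-set graph (H, TS(H)) arises from a decomposition tree, and suppose that for every twin-set graph H' occurring in this construction and every 0 ≤ k ≤ |TS(H')| the family D_k(H') is nonempty. If β(H) > 0, then there exists D ∈ D_0(H) with D ∩ TS(H) ≠ ∅. -/

import Mathlib

/-- A finite simple graph on a subset of an ambient vertex type `α`,
together with a designated twin set `TS ⊆ verts`. -/
structure TSGraph (α : Type*) where
  verts : Finset α
  Adj : α → α → Prop
  symm : ∀ u v, Adj u v → Adj v u
  irrefl : ∀ u, ¬ Adj u u
  adj_mem : ∀ u v, Adj u v → u ∈ verts ∧ v ∈ verts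
  TS : Finset α
  TS_sub : TS ⊆ verts

namespace TSGraph

variable {α : Type*} [DecidableEq α]

/-- `f` encodes a perfect matching of the subgraph of `G` induced by `S`:
every vertex of `S` is paired with an adjacent vertex of `S`, involutively. -/
def IsPM (G : TSGraph α) (S : Finset α) (f : α → α) : Prop :=
  ∀ v ∈ S, f v ∈ S ∧ G.Adj v (f v) ∧ f (f v) = v

/-- `S ⊆ V(G)` dominates `V(G) − TS(G)` and, for some `X ⊆ S ∩ TS(G)` of size `k`,
the subgraph induced by `S − X` has a perfect matching. -/
def Adm (G : TSGraph α) (k : ℕ) (S : Finset α) : Prop :=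
  S ⊆ G.verts ∧
  (∀ v ∈ G.verts, v ∉ G.TS → v ∈ S ∨ ∃ u ∈ S, G.Adj u v) ∧
  ∃ X ⊆ S ∩ G.TS, X.card = k ∧ ∃ f, G.IsPM (S \ X) f

/-- Membership in the family `D_k(G)`: admissible of minimum cardinality. -/
def memD (G : TSGraph α) (k : ℕ) (S : Finset α) : Prop :=
  G.Adm k S ∧ ∀ S', G.Adm k S' → S.card ≤ S'.card

/-- `D_k(G) ≠ ∅`. -/
def DkNonempty (G : TSGraph α) (k : ℕ) : Prop := ∃ S, G.memD k S

/-- `D_k(G) ≠ ∅` for all `0 ≤ k ≤ |TS(G)|`. -/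
def AllDkNonempty (G : TSGraph α) : Prop := ∀ k ≤ G.TS.card, G.DkNonempty k

/-- `γ_k(G)`: the common cardinality of the members of `D_k(G)`. -/
noncomputable def gamma (G : TSGraph α) (k : ℕ) : ℕ :=
  sInf {n | ∃ S, G.Adm k S ∧ S.card = n}

/-- A paired-dominating set of `G`. -/
def IsPDS (G : TSGraph α) (D : Finset α) : Prop :=
  D ⊆ G.verts ∧
  (∀ v ∈ G.verts, v ∈ D ∨ ∃ u ∈ D, G.Adj u v) ∧
  ∃ f, G.IsPM D f

/-- `γ_p(G)`: the paired-domination number. -/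
noncomputable def gammaP (G : TSGraph α) : ℕ :=
  sInf {n | ∃ D, G.IsPDS D ∧ D.card = n}

/-- Membership in `D_p(G)`: minimum-cardinality paired-dominating sets. -/
def memDp (G : TSGraph α) (D : Finset α) : Prop :=
  G.IsPDS D ∧ D.card = G.gammaP

/-- `min(G) = min { γ_k(G) : 0 ≤ k ≤ |TS(G)| }`. -/
noncomputable def minVal (G : TSGraph α) : ℕ :=
  sInf {n | ∃ k ≤ G.TS.card, G.gamma k = n}

/-- `α(G)`: the smallest `k` with `γ_k(G) = min(G)`. -/
noncomputable def alphaVal (G : TSGraph α) : ℕ :=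
  sInf {k | k ≤ G.TS.card ∧ G.gamma k = G.minVal}

/-- `β(G)`: the largest `k` with `γ_k(G) = min(G)`. -/
noncomputable def betaVal (G : TSGraph α) : ℕ :=
  sSup {k | k ≤ G.TS.card ∧ G.gamma k = G.minVal}

/-- Membership in `Ψ(G)`: sets in some `D_k(G)` of cardinality `min(G)`. -/
def memPsi (G : TSGraph α) (D : Finset α) : Prop :=
  (∃ k, k ≤ G.TS.card ∧ G.memD k D) ∧ D.card = G.minVal

/-- Equation (2) holds for `G`. -/
def Eq2Holds (G : TSGraph α) : Prop :=
  ∀ k ≤ G.TS.card,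
    (k ≤ G.alphaVal → G.gamma k = G.minVal + G.alphaVal - k) ∧
    (G.betaVal ≤ k → G.gamma k = G.minVal + k - G.betaVal) ∧
    (G.alphaVal < k → k < G.betaVal → Even (k - G.alphaVal) → G.gamma k = G.minVal) ∧
    (G.alphaVal < k → k < G.betaVal → ¬ Even (k - G.alphaVal) → G.gamma k = G.minVal + 1)

/-- `G = Gl ⊗ Gr` (true twin composition). -/
def IsTrueTwin (G Gl Gr : TSGraph α) : Prop :=
  Disjoint Gl.verts Gr.verts ∧
  G.verts = Gl.verts ∪ Gr.verts ∧
  (∀ u v, G.Adj u v ↔ Gl.Adj u v ∨ Gr.Adj u v ∨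
    (u ∈ Gl.TS ∧ v ∈ Gr.TS) ∨ (u ∈ Gr.TS ∧ v ∈ Gl.TS)) ∧
  G.TS = Gl.TS ∪ Gr.TS

/-- `G = Gl ⊙ Gr` (false twin composition). -/
def IsFalseTwin (G Gl Gr : TSGraph α) : Prop :=
  Disjoint Gl.verts Gr.verts ∧
  G.verts = Gl.verts ∪ Gr.verts ∧
  (∀ u v, G.Adj u v ↔ Gl.Adj u v ∨ Gr.Adj u v) ∧
  G.TS = Gl.TS ∪ Gr.TS

/-- `G = Gl ⊕ Gr` (attachment composition). -/
def IsAttach (G Gl Gr : TSGraph α) : Prop :=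
  Disjoint Gl.verts Gr.verts ∧
  G.verts = Gl.verts ∪ Gr.verts ∧
  (∀ u v, G.Adj u v ↔ Gl.Adj u v ∨ Gr.Adj u v ∨
    (u ∈ Gl.TS ∧ v ∈ Gr.TS) ∨ (u ∈ Gr.TS ∧ v ∈ Gl.TS)) ∧
  G.TS = Gl.TS

/-- The twin-set graph `G` arises from a decomposition tree all of whose associated
twin-set graphs satisfy the property `P`. -/
inductive FromDecompTree (P : TSGraph α → Prop) : TSGraph α → Prop where
  | single (G : TSGraph α) (v : α) (hv : G.verts = {v}) (hts : G.TS = {v})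
      (hadj : ∀ u w, ¬ G.Adj u w) (hP : P G) : FromDecompTree P G
  | ttwin (G Gl Gr : TSGraph α) (hl : FromDecompTree P Gl) (hr : FromDecompTree P Gr)
      (h : IsTrueTwin G Gl Gr) (hP : P G) : FromDecompTree P G
  | ftwin (G Gl Gr : TSGraph α) (hl : FromDecompTree P Gl) (hr : FromDecompTree P Gr)
      (h : IsFalseTwin G Gl Gr) (hP : P G) : FromDecompTree P G
  | attach (G Gl Gr : TSGraph α) (hl : FromDecompTree P Gl) (hr : FromDecompTree P Gr)
      (h : IsAttach G Gl Gr) (hP : P G) : FromDecompTree P G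

end TSGraph

namespace TSGraph

variable {α : Type*} [DecidableEq α]

/-- Some admissible `k`-set has cardinality `n`. -/
def Has (G : TSGraph α) (k n : ℕ) : Prop := ∃ S, G.Adm k S ∧ S.card = n

/-- Some admissible `0`-set meeting the twin set has cardinality `n`. -/
def Hit (G : TSGraph α) (n : ℕ) : Prop :=
  ∃ S, G.Adm 0 S ∧ S.card = n ∧ (S ∩ G.TS).Nonempty

/-- Some paired dominating set has cardinality `n`. -/
def Pds (G : TSGraph α) (n : ℕ) : Prop :=
  ∃ S, G.Adm 0 S ∧ S.card = n ∧ ∀ v ∈ G.verts, v ∈ S ∨ ∃ u ∈ S, G.Adj u v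

theorem IsPM.even {G : TSGraph α} {S : Finset α} {f : α → α} (h : G.IsPM S f) :
    S.card % 2 = 0 := by
  have h1 : ∑ _x ∈ S, (1 : ZMod 2) = 0 := by
    refine Finset.sum_involution (fun a _ => f a) ?_ ?_ ?_ ?_
    · intro a ha; decide
    · intro a ha _ he
      exact G.irrefl a (by simpa [he] using (h a ha).2.1)
    · intro a ha; exact (h a ha).1
    · intro a ha; exact (h a ha).2.2
  simp only [Finset.sum_const, nsmul_eq_mul, mul_one] at h1
  rw [ZMod.natCast_eq_zero_iff] at h1
  omega

theorem IsPM.insert_pair {G : TSGraph α} {S : Finset α} {f : α → α} (h : G.IsPM S f)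
    {u v : α} (hu : u ∉ S) (hv : v ∉ S) (huv : G.Adj u v) :
    ∃ g, G.IsPM (insert u (insert v S)) g := by
  have hne : u ≠ v := by rintro rfl; exact G.irrefl _ huv
  have hvu := G.symm _ _ huv
  refine ⟨fun x => if x = u then v else if x = v then u else f x, ?_⟩
  intro x hx
  simp only [IsPM] at h
  by_cases h1 : x = u
  · subst h1; simp [hne.symm, huv]
  by_cases h2 : x = v
  · subst h2; simp [hne.symm, hvu]
  have hxS : x ∈ S := by simpa [h1, h2] using hx
  obtain ⟨a, b, c⟩ := h x hxS
  have h3 : f x ≠ u := by rintro e; rw [e] at a; exact hu a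
  have h4 : f x ≠ v := by rintro e; rw [e] at a; exact hv a
  simp [h1, h2, h3, h4, a, b, c]

theorem IsPM.cross {G : TSGraph α} (m : ℕ) : ∀ {T : Finset α} {f : α → α} (_ : G.IsPM T f)
    {Y Z : Finset α} (_ : Disjoint Y T) (_ : Disjoint Z T) (_ : Disjoint Y Z)
    (_ : Y.card = m) (_ : Z.card = m) (_ : ∀ u ∈ Y, ∀ v ∈ Z, G.Adj u v),
    ∃ g, G.IsPM (T ∪ (Y ∪ Z)) g := by
  induction m with
  | zero =>
    intro T f h Y Z _ _ _ hY hZ _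
    rw [Finset.card_eq_zero] at hY hZ
    subst hY; subst hZ
    exact ⟨f, by simpa using h⟩
  | succ m ih =>
    intro T f h Y Z h1 h2 h3 hY hZ had
    obtain ⟨y, Y', hy, rfl, hY'⟩ := Finset.card_eq_succ.1 hY
    obtain ⟨z, Z', hz, rfl, hZ'⟩ := Finset.card_eq_succ.1 hZ
    obtain ⟨g, hg⟩ := ih h (Y := Y') (Z := Z') (by simp_all) (by simp_all) (by simp_all) hY' hZ'
      (by intro u hu v hv; exact had u (by simp [hu]) v (by simp [hv]))
    simp only [Finset.disjoint_insert_left, Finset.disjoint_insert_right, Finset.mem_insert,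
      not_or] at h1 h2 h3
    obtain ⟨g', hg'⟩ := hg.insert_pair (u := y) (v := z) (by simp_all)
      (by simp_all) (had y (by simp) z (by simp))
    refine ⟨g', ?_⟩
    convert hg' using 1
    ext x; simp; tauto

theorem Adm.parity {G : TSGraph α} {k : ℕ} {S : Finset α} (h : G.Adm k S) :
    (S.card + k) % 2 = 0 ∧ k ≤ G.TS.card := by
  obtain ⟨_, _, X, hX, rfl, f, hf⟩ := h
  have h1 := hf.even
  have h2 : X ⊆ S := hX.trans Finset.inter_subset_left
  rw [Finset.card_sdiff_of_subset h2] at h1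
  have h3 := Finset.card_le_card h2
  have h4 := Finset.card_le_card (hX.trans Finset.inter_subset_right)
  omega

theorem Has.parity {G : TSGraph α} {k n : ℕ} (h : G.Has k n) :
    (n + k) % 2 = 0 ∧ k ≤ G.TS.card := by
  obtain ⟨S, hS, rfl⟩ := h
  exact hS.parity

theorem Has.down {G : TSGraph α} {k n : ℕ} (h : G.Has (k + 1) n) :
    ∃ n' ≤ n + 1, G.Has k n' := by
  obtain ⟨S, ⟨hS, hdom, X, hX, hc, f, hf⟩, rfl⟩ := h
  obtain ⟨x, X', hx, rfl, hX'⟩ := Finset.card_eq_succ.1 hc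
  have hxS : x ∈ S ∩ G.TS := hX (by simp)
  have hX'S : X' ⊆ S ∩ G.TS := fun a ha => hX (by simp [ha])
  rw [Finset.mem_inter] at hxS
  by_cases hw : ∃ w, w ∉ S ∧ G.Adj x w
  · obtain ⟨w, hw, hxw⟩ := hw
    refine ⟨_, (Finset.card_insert_le w S), insert w S, ⟨?_, ?_, X', ?_, hX', ?_⟩, rfl⟩
    · intro a ha
      rcases Finset.mem_insert.1 ha with rfl | ha
      · exact (G.adj_mem _ _ hxw).2
      · exact hS ha
    · intro v hv hvT
      rcases hdom v hv hvT with h | ⟨u, hu, h⟩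
      · simp [h]
      · exact Or.inr ⟨u, by simp [hu], h⟩
    · intro a ha
      have := hX'S ha
      simp at this ⊢; tauto
    · obtain ⟨g, hg⟩ := hf.insert_pair (u := x) (v := w) (by simp) (by simp [hw]) hxw
      refine ⟨g, ?_⟩
      convert hg using 1
      ext a
      have : w ∉ X' := fun h => hw (Finset.mem_inter.1 (hX'S h)).1
      simp only [Finset.mem_sdiff, Finset.mem_insert]
      by_cases a = x <;> by_cases a = w <;> simp_all
  · push Not at hw
    refine ⟨(S.erase x).card, (Finset.card_erase_le).trans (by omega), S.erase x,
      ⟨(Finset.erase_subset _ _).trans hS, ?_, X', ?_, hX', f, ?_⟩, rfl⟩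
    · intro v hv hvT
      have hvx : v ≠ x := by rintro rfl; exact hvT hxS.2
      rcases hdom v hv hvT with h | ⟨u, hu, h⟩
      · simp [h, hvx]
      · by_cases hux : u = x
        · subst hux
          left
          by_contra hc
          exact hw v (by simpa [hvx] using hc) h
        · exact Or.inr ⟨u, by simp [hu, hux], h⟩
    · intro a ha
      have := hX'S ha
      have : a ≠ x := by rintro rfl; exact hx ha
      simp_all
    · convert hf using 1
      ext a
      simp; tauto

theorem Has.up {G : TSGraph α} {k n : ℕ} (h : G.Has k n) (hk : k < G.TS.card) :
    ∃ n' ≤ n + 1, G.Has (k + 1) n' := by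
  obtain ⟨S, ⟨hS, hdom, X, hX, hc, f, hf⟩, rfl⟩ := h
  by_cases ht : ∃ t ∈ G.TS, t ∉ S
  · obtain ⟨t, ht, htS⟩ := ht
    have htX : t ∉ X := fun h => htS (Finset.mem_inter.1 (hX h)).1
    refine ⟨_, (Finset.card_insert_le t S), insert t S, ⟨?_, ?_, insert t X, ?_, ?_, f, ?_⟩, rfl⟩
    · intro a ha
      rcases Finset.mem_insert.1 ha with rfl | ha
      · exact G.TS_sub ht
      · exact hS ha
    · intro v hv hvT
      rcases hdom v hv hvT with h | ⟨u, hu, h⟩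
      · simp [h]
      · exact Or.inr ⟨u, by simp [hu], h⟩
    · intro a ha
      have := @hX a
      simp at this ha ⊢
      rcases ha with rfl | ha
      · simp [ht]
      · simp [this ha]
    · rw [Finset.card_insert_of_notMem htX, hc]
    · convert hf using 1
      ext a
      simp only [Finset.mem_sdiff, Finset.mem_insert]
      by_cases a = t <;> simp_all
  · push Not at ht
    have hXT : X ⊆ G.TS := hX.trans Finset.inter_subset_right
    obtain ⟨t, htT, htX⟩ : ∃ t ∈ G.TS, t ∉ X := by
      by_contra hcon
      push Not at hcon
      have := Finset.card_le_card (show G.TS ⊆ X from hcon)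
      omega
    have htS := ht t htT
    obtain ⟨hu, htu, hft⟩ := hf t (by simp [htS, htX])
    set u := f t with hudef
    simp only [Finset.mem_sdiff] at hu
    have hne : u ≠ t := by intro e; rw [e] at htu; exact G.irrefl _ htu
    have hf' : G.IsPM ((S \ X) \ {t, u}) f := by
      intro v hv
      simp only [Finset.mem_sdiff, Finset.mem_insert, Finset.mem_singleton, not_or] at hv
      obtain ⟨a, b, c⟩ := hf v (by simp [hv])
      refine ⟨?_, b, c⟩
      simp only [Finset.mem_sdiff, Finset.mem_insert, Finset.mem_singleton, not_or] at a ⊢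
      refine ⟨a, ?_, ?_⟩
      · intro e; rw [e] at c; exact hv.2.2 c.symm
      · intro e; rw [e, hft] at c; exact hv.2.1 c.symm
    by_cases hw : ∃ w, w ∉ S ∧ G.Adj u w
    · obtain ⟨w, hw, huw⟩ := hw
      have hwX : w ∉ X := fun h => hw (Finset.mem_inter.1 (hX h)).1
      have hwt : w ≠ t := by rintro rfl; exact hw htS
      have hwu : w ≠ u := by rintro rfl; exact hw hu.1
      refine ⟨_, (Finset.card_insert_le w S), insert w S, ⟨?_, ?_, insert t X, ?_, ?_, ?_⟩, rfl⟩
      · intro a ha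
        rcases Finset.mem_insert.1 ha with rfl | ha
        · exact (G.adj_mem _ _ huw).2
        · exact hS ha
      · intro v hv hvT
        rcases hdom v hv hvT with h | ⟨u, hu, h⟩
        · simp [h]
        · exact Or.inr ⟨u, by simp [hu], h⟩
      · intro a ha
        have := @hX a
        simp at this ha ⊢
        rcases ha with rfl | ha
        · simp [htT, htS]
        · simp [this ha]
      · rw [Finset.card_insert_of_notMem htX, hc]
      · obtain ⟨g, hg⟩ := hf'.insert_pair (u := u) (v := w) (by simp) (by simp [hw]) huw
        refine ⟨g, ?_⟩
        convert hg using 1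
        ext a
        simp only [Finset.mem_sdiff, Finset.mem_insert, Finset.mem_singleton]
        by_cases h1 : a = t
        · subst h1; simp [hne.symm, hwt.symm]
        by_cases h2 : a = w
        · subst h2; simp [hwX, h1]
        by_cases h3 : a = u
        · subst h3; simp [hu, h1]
        simp [h1, h2, h3]
    · push Not at hw
      refine ⟨(S.erase u).card, (Finset.card_erase_le).trans (by omega), S.erase u,
        ⟨(Finset.erase_subset _ _).trans hS, ?_, insert t X, ?_, ?_, f, ?_⟩, rfl⟩
      · intro v hv hvT
        by_cases hvu : v = u
        · exact Or.inr ⟨t, by simp [hne.symm, htS], hvu ▸ htu⟩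
        rcases hdom v hv hvT with h | ⟨y, hy, h⟩
        · simp [h, hvu]
        · by_cases hyu : y = u
          · left
            by_contra hc
            exact hw v (by simpa [hvu] using hc) (hyu ▸ h)
          · exact Or.inr ⟨y, by simp [hy, hyu], h⟩
      · intro a ha
        have h1 := @hX a
        simp only [Finset.mem_insert, Finset.mem_inter, Finset.mem_erase] at h1 ha ⊢
        rcases ha with rfl | ha
        · simp [htT, htS, hne.symm]
        · refine ⟨⟨?_, (h1 ha).1⟩, (h1 ha).2⟩
          rintro rfl; exact hu.2 ha
      · rw [Finset.card_insert_of_notMem htX, hc]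
      · convert hf' using 1
        ext a
        simp; tauto

/-- From a `0`-set: either it contains the whole twin set or one more vertex gives a `1`-set. -/
theorem Has.up_zero {G : TSGraph α} {S : Finset α} (h : G.Adm 0 S) :
    G.TS ⊆ S ∨ G.Has 1 (S.card + 1) := by
  by_cases ht : ∃ t ∈ G.TS, t ∉ S
  · right
    obtain ⟨hS, hdom, X, hX, hc, f, hf⟩ := h
    obtain rfl := Finset.card_eq_zero.1 hc
    obtain ⟨t, ht, htS⟩ := ht
    refine ⟨insert t S, ⟨?_, ?_, {t}, ?_, ?_, f, ?_⟩, by simp [htS]⟩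
    · intro a ha
      rcases Finset.mem_insert.1 ha with rfl | ha
      · exact G.TS_sub ht
      · exact hS ha
    · intro v hv hvT
      rcases hdom v hv hvT with h | ⟨u, hu, h⟩
      · simp [h]
      · exact Or.inr ⟨u, by simp [hu], h⟩
    · simp [ht]
    · simp
    · convert hf using 1
      ext a
      simp only [Finset.mem_sdiff, Finset.mem_insert]
      by_cases a = t <;> simp_all
  · left
    push Not at ht
    exact ht

/-- Splitting an admissible set along a composition. -/
theorem split {G Gl Gr : TSGraph α} (hd : Disjoint Gl.verts Gr.verts)
    (hv : G.verts = Gl.verts ∪ Gr.verts)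
    (hadj : ∀ u v, G.Adj u v → Gl.Adj u v ∨ Gr.Adj u v ∨
      (u ∈ Gl.TS ∧ v ∈ Gr.TS) ∨ (u ∈ Gr.TS ∧ v ∈ Gl.TS))
    {S X : Finset α} {f : α → α} (hS : S ⊆ G.verts) (hXS : X ⊆ S)
    (hX : X ⊆ Gl.TS ∪ Gr.TS) (hf : G.IsPM (S \ X) f)
    (hdl : ∀ v ∈ Gl.verts, v ∉ Gl.TS → v ∈ S ∨ ∃ u ∈ S, G.Adj u v)
    (hdr : ∀ v ∈ Gr.verts, v ∉ Gr.TS → v ∈ S ∨ ∃ u ∈ S, G.Adj u v) :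
    ∃ m, Gl.Adm ((X ∩ Gl.verts).card + m) (S ∩ Gl.verts) ∧
      Gr.Adm ((X ∩ Gr.verts).card + m) (S ∩ Gr.verts) ∧
      (0 < m → ∃ u ∈ Gl.verts, ∃ v ∈ Gr.verts, G.Adj u v) ∧
      (0 < m → (S ∩ Gl.TS).Nonempty) ∧
      S.card = (S ∩ Gl.verts).card + (S ∩ Gr.verts).card ∧
      X.card = (X ∩ Gl.verts).card + (X ∩ Gr.verts).card := by
  have hd' : ∀ a, a ∈ Gl.verts → a ∉ Gr.verts := fun a h1 h2 => Finset.disjoint_left.1 hd h1 h2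
  have hTl := fun a => @Gl.TS_sub a
  have hTr := fun a => @Gr.TS_sub a
  have hAl := Gl.adj_mem
  have hAr := Gr.adj_mem
  have hS' : ∀ a ∈ S, a ∈ Gl.verts ∨ a ∈ Gr.verts := by
    intro a ha; simpa [hv] using hS ha
  have cardsplit : ∀ T ⊆ S, T.card = (T ∩ Gl.verts).card + (T ∩ Gr.verts).card := by
    intro T hT
    rw [← Finset.card_union_of_disjoint, ← Finset.inter_union_distrib_left, ← hv,
      Finset.inter_eq_left.2 (hT.trans hS)]
    exact hd.mono Finset.inter_subset_right Finset.inter_subset_right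
  set Ml := ((S \ X) ∩ Gl.verts).filter (fun v => f v ∈ Gr.verts) with hMl
  set Mr := ((S \ X) ∩ Gr.verts).filter (fun v => f v ∈ Gl.verts) with hMr
  have hcard : Ml.card = Mr.card := by
    refine Finset.card_bij' (fun a _ => f a) (fun a _ => f a) ?_ ?_ ?_ ?_
    all_goals
      intro a ha
      have := hf a
      grind
  have hMlT : ∀ a ∈ Ml, a ∈ Gl.TS := by
    intro a ha
    have h1 := hf a
    have h2 := hadj a (f a)
    grind
  have hMrT : ∀ a ∈ Mr, a ∈ Gr.TS := by
    intro a ha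
    have h1 := hf a
    have h2 := hadj a (f a)
    grind
  have hXl : ∀ a ∈ X, a ∈ Gl.verts → a ∈ Gl.TS := by
    intro a ha h1
    have := hX ha
    grind
  have hXr : ∀ a ∈ X, a ∈ Gr.verts → a ∈ Gr.TS := by
    intro a ha h1
    have := hX ha
    grind
  refine ⟨Ml.card, ⟨Finset.inter_subset_right, ?_, (X ∩ Gl.verts) ∪ Ml, ?_, ?_, f, ?_⟩,
    ⟨Finset.inter_subset_right, ?_, (X ∩ Gr.verts) ∪ Mr, ?_, ?_, f, ?_⟩, ?_, ?_,
    cardsplit S subset_rfl, cardsplit X hXS⟩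
  · intro v h1 h2
    rcases hdl v h1 h2 with h | ⟨u, hu, h⟩
    · grind
    · have := hadj u v h
      right
      refine ⟨u, ?_, ?_⟩ <;> grind
  · intro a ha; grind
  · apply Finset.card_union_of_disjoint
    rw [Finset.disjoint_left]
    intro a h1 h2; grind
  · intro a ha
    have h1 := hf a
    have h2 := hadj a (f a)
    have h3 := hf (f a)
    grind
  · intro v h1 h2
    rcases hdr v h1 h2 with h | ⟨u, hu, h⟩
    · grind
    · have := hadj u v h
      right
      refine ⟨u, ?_, ?_⟩ <;> grind
  · intro a ha; grind
  · rw [hcard]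
    apply Finset.card_union_of_disjoint
    rw [Finset.disjoint_left]
    intro a h1 h2; grind
  · intro a ha
    have h1 := hf a
    have h2 := hadj a (f a)
    have h3 := hf (f a)
    grind
  · intro h
    obtain ⟨a, ha⟩ := Finset.card_pos.1 h
    have h1 := hf a
    refine ⟨a, ?_, f a, ?_, ?_⟩ <;> grind
  · intro h
    obtain ⟨a, ha⟩ := Finset.card_pos.1 h
    exact ⟨a, by grind⟩

/-- Gluing: the matching part. -/
theorem glue {G Gl Gr : TSGraph α} (hd : Disjoint Gl.verts Gr.verts)
    (hl : ∀ u v, Gl.Adj u v → G.Adj u v) (hr : ∀ u v, Gr.Adj u v → G.Adj u v)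
    {m : ℕ} (hm : 0 < m → ∀ u ∈ Gl.TS, ∀ v ∈ Gr.TS, G.Adj u v)
    {Sl Sr Yl Yr : Finset α} {fl fr : α → α} (hSl : Sl ⊆ Gl.verts) (hSr : Sr ⊆ Gr.verts)
    (hYl : Yl ⊆ Sl ∩ Gl.TS) (hYr : Yr ⊆ Sr ∩ Gr.TS)
    (hfl : Gl.IsPM (Sl \ Yl) fl) (hfr : Gr.IsPM (Sr \ Yr) fr)
    (h1 : m ≤ Yl.card) (h2 : m ≤ Yr.card) :
    ∃ Xl ⊆ Yl, ∃ Xr ⊆ Yr, Xl.card + m = Yl.card ∧ Xr.card + m = Yr.card ∧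
      (Xl ∪ Xr).card = Xl.card + Xr.card ∧ (Sl ∪ Sr).card = Sl.card + Sr.card ∧
      ∃ f, G.IsPM ((Sl ∪ Sr) \ (Xl ∪ Xr)) f := by
  obtain ⟨Ml, hMl, cl⟩ := Finset.exists_subset_card_eq h1
  obtain ⟨Mr, hMr, cr⟩ := Finset.exists_subset_card_eq h2
  have hd' : ∀ a, a ∈ Gl.verts → a ∉ Gr.verts := fun a h1 h2 => Finset.disjoint_left.1 hd h1 h2
  have hS : Disjoint Sl Sr := hd.mono hSl hSr
  have hYl' : Yl ⊆ Sl := hYl.trans Finset.inter_subset_left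
  have hYr' : Yr ⊆ Sr := hYr.trans Finset.inter_subset_left
  have hbase : G.IsPM ((Sl \ Yl) ∪ (Sr \ Yr)) (fun x => if x ∈ Gl.verts then fl x else fr x) := by
    intro v hv
    have a1 := hfl v
    have a2 := hfr v
    have a3 := hl v (fl v)
    have a4 := hr v (fr v)
    grind
  have hdis := Finset.disjoint_left.1 hS
  obtain ⟨g, hg⟩ := hbase.cross m (Y := Ml) (Z := Mr)
    (by rw [Finset.disjoint_left]; intro a; grind)
    (by rw [Finset.disjoint_left]; intro a; grind)
    (by rw [Finset.disjoint_left]; intro a; grind) cl cr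
    (by
      intro u hu v hv
      exact hm (cl ▸ Finset.card_pos.2 ⟨u, hu⟩) u (by grind) v (by grind))
  refine ⟨Yl \ Ml, Finset.sdiff_subset, Yr \ Mr, Finset.sdiff_subset, ?_, ?_, ?_, ?_, g, ?_⟩
  · rw [Finset.card_sdiff_of_subset hMl]; omega
  · rw [Finset.card_sdiff_of_subset hMr]; omega
  · apply Finset.card_union_of_disjoint
    exact hS.mono (Finset.sdiff_subset.trans hYl') (Finset.sdiff_subset.trans hYr')
  · exact Finset.card_union_of_disjoint hS
  · convert hg using 1
    ext a
    grind

theorem dom_split {G Gl Gr : TSGraph α} (hd : Disjoint Gl.verts Gr.verts)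
    (hv : G.verts = Gl.verts ∪ Gr.verts) (hT : G.TS = Gl.TS ∪ Gr.TS) {S : Finset α}
    (hdom : ∀ v ∈ G.verts, v ∉ G.TS → v ∈ S ∨ ∃ u ∈ S, G.Adj u v) :
    (∀ v ∈ Gl.verts, v ∉ Gl.TS → v ∈ S ∨ ∃ u ∈ S, G.Adj u v) ∧
    (∀ v ∈ Gr.verts, v ∉ Gr.TS → v ∈ S ∨ ∃ u ∈ S, G.Adj u v) := by
  have hd' := Finset.disjoint_left.1 hd
  constructor
  · intro v h1 h2
    refine hdom v (by simp [hv, h1]) ?_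
    rw [hT, Finset.mem_union]
    rintro (h | h)
    · exact h2 h
    · exact hd' h1 (Gr.TS_sub h)
  · intro v h1 h2
    refine hdom v (by simp [hv, h1]) ?_
    rw [hT, Finset.mem_union]
    rintro (h | h)
    · exact hd' (Gl.TS_sub h) h1
    · exact h2 h

theorem dom_glue {G Gl Gr : TSGraph α}
    (hv : G.verts = Gl.verts ∪ Gr.verts) (hT : G.TS = Gl.TS ∪ Gr.TS)
    (hl : ∀ u v, Gl.Adj u v → G.Adj u v) (hr : ∀ u v, Gr.Adj u v → G.Adj u v)
    {Sl Sr : Finset α}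
    (hdl : ∀ v ∈ Gl.verts, v ∉ Gl.TS → v ∈ Sl ∨ ∃ u ∈ Sl, Gl.Adj u v)
    (hdr : ∀ v ∈ Gr.verts, v ∉ Gr.TS → v ∈ Sr ∨ ∃ u ∈ Sr, Gr.Adj u v) :
    ∀ v ∈ G.verts, v ∉ G.TS → v ∈ Sl ∪ Sr ∨ ∃ u ∈ Sl ∪ Sr, G.Adj u v := by
  intro v h1 h2
  simp only [hv, hT, Finset.mem_union, not_or] at h1 h2 ⊢
  rcases h1 with h1 | h1
  · rcases hdl v h1 h2.1 with h | ⟨u, hu, h⟩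
    · simp [h]
    · exact Or.inr ⟨u, by simp [hu], hl _ _ h⟩
  · rcases hdr v h1 h2.2 with h | ⟨u, hu, h⟩
    · simp [h]
    · exact Or.inr ⟨u, by simp [hu], hr _ _ h⟩

/-- Gluing admissible sets for the twin operations. -/
theorem twin_glue {G Gl Gr : TSGraph α} (hd : Disjoint Gl.verts Gr.verts)
    (hv : G.verts = Gl.verts ∪ Gr.verts) (hT : G.TS = Gl.TS ∪ Gr.TS)
    (hl : ∀ u v, Gl.Adj u v → G.Adj u v) (hr : ∀ u v, Gr.Adj u v → G.Adj u v)
    {m a b : ℕ} (hm : 0 < m → ∀ u ∈ Gl.TS, ∀ v ∈ Gr.TS, G.Adj u v)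
    {Sl Sr : Finset α} (hSl : Gl.Adm a Sl) (hSr : Gr.Adm b Sr) (h1 : m ≤ a) (h2 : m ≤ b) :
    G.Adm (a + b - 2 * m) (Sl ∪ Sr) ∧ (Sl ∪ Sr).card = Sl.card + Sr.card := by
  obtain ⟨hl1, hl2, Yl, hYl, rfl, fl, hfl⟩ := hSl
  obtain ⟨hr1, hr2, Yr, hYr, rfl, fr, hfr⟩ := hSr
  obtain ⟨Xl, hXl, Xr, hXr, c1, c2, c3, c4, f, hf⟩ :=
    glue hd hl hr hm hl1 hr1 hYl hYr hfl hfr h1 h2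
  refine ⟨⟨?_, dom_glue hv hT hl hr hl2 hr2, Xl ∪ Xr, ?_, by omega, f, hf⟩, c4⟩
  · rw [hv]; exact Finset.union_subset_union hl1 hr1
  · intro x hx
    rw [hT]
    grind

theorem ft_split {G Gl Gr : TSGraph α} (h : IsFalseTwin G Gl Gr) {k n : ℕ} (hn : G.Has k n) :
    ∃ a b nl nr, Gl.Has a nl ∧ Gr.Has b nr ∧ n = nl + nr ∧ k = a + b := by
  obtain ⟨hd, hv, hadj, hT⟩ := h
  obtain ⟨S, ⟨hS, hdom, X, hX, rfl, f, hf⟩, rfl⟩ := hn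
  have hX1 := hX.trans Finset.inter_subset_left
  have hX2 := hX.trans Finset.inter_subset_right
  obtain ⟨d1, d2⟩ := dom_split hd hv hT hdom
  obtain ⟨m, h1, h2, h3, -, h5, h6⟩ := split hd hv (fun u v huv => by
    rcases (hadj u v).1 huv with h | h <;> simp [h]) hS hX1 (hT ▸ hX2) hf d1 d2
  have hm : m = 0 := by
    by_contra hm
    obtain ⟨u, hu, v, hv', huv⟩ := h3 (by omega)
    have hd' := Finset.disjoint_left.1 hd
    rcases (hadj u v).1 huv with h | h
    · exact hd' (Gl.adj_mem _ _ h).2 hv'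
    · exact hd' hu (Gr.adj_mem _ _ h).1
  subst hm
  exact ⟨_, _, _, _, ⟨_, h1, rfl⟩, ⟨_, h2, rfl⟩, h5, h6⟩

theorem ft_glue {G Gl Gr : TSGraph α} (h : IsFalseTwin G Gl Gr) {a b nl nr : ℕ}
    (h1 : Gl.Has a nl) (h2 : Gr.Has b nr) : G.Has (a + b) (nl + nr) := by
  obtain ⟨hd, hv, hadj, hT⟩ := h
  obtain ⟨Sl, hSl, rfl⟩ := h1
  obtain ⟨Sr, hSr, rfl⟩ := h2
  obtain ⟨h3, h4⟩ := twin_glue (m := 0) hd hv hT (fun u v h => (hadj u v).2 (by simp [h]))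
    (fun u v h => (hadj u v).2 (by simp [h])) (by simp) hSl hSr (by simp) (by simp)
  exact ⟨_, h3, h4⟩

theorem ft_hit {G Gl Gr : TSGraph α} (h : IsFalseTwin G Gl Gr) {nl nr : ℕ}
    (h1 : Gl.Has 0 nl) (h2 : Gr.Has 0 nr) (h3 : Gl.Hit nl ∨ Gr.Hit nr) : G.Hit (nl + nr) := by
  obtain ⟨hd, hv, hadj, hT⟩ := h
  obtain ⟨Sl, hSl, hcl, Sr, hSr, hcr, hh⟩ : ∃ Sl, Gl.Adm 0 Sl ∧ Sl.card = nl ∧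
      ∃ Sr, Gr.Adm 0 Sr ∧ Sr.card = nr ∧ ((Sl ∩ Gl.TS).Nonempty ∨ (Sr ∩ Gr.TS).Nonempty) := by
    obtain ⟨Sl, hSl, hcl⟩ := h1
    obtain ⟨Sr, hSr, hcr⟩ := h2
    rcases h3 with ⟨S, a, b, c⟩ | ⟨S, a, b, c⟩
    · exact ⟨S, a, b, Sr, hSr, hcr, Or.inl c⟩
    · exact ⟨Sl, hSl, hcl, S, a, b, Or.inr c⟩
  obtain ⟨h3, h4⟩ := twin_glue (m := 0) hd hv hT (fun u v h => (hadj u v).2 (by simp [h]))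
    (fun u v h => (hadj u v).2 (by simp [h])) (by simp) hSl hSr (by simp) (by simp)
  refine ⟨_, h3, by omega, ?_⟩
  rw [hT]
  rcases hh with ⟨x, hx⟩ | ⟨x, hx⟩ <;> exact ⟨x, by simp at hx ⊢; tauto⟩

theorem tt_split {G Gl Gr : TSGraph α} (h : IsTrueTwin G Gl Gr) {S : Finset α} {k : ℕ}
    (hn : G.Adm k S) :
    ∃ a b m nl nr, Gl.Has (a + m) nl ∧ Gr.Has (b + m) nr ∧ S.card = nl + nr ∧ k = a + b ∧
      (0 < m → (S ∩ G.TS).Nonempty) := by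
  obtain ⟨hd, hv, hadj, hT⟩ := h
  obtain ⟨hS, hdom, X, hX, rfl, f, hf⟩ := hn
  have hX1 := hX.trans Finset.inter_subset_left
  have hX2 := hX.trans Finset.inter_subset_right
  obtain ⟨d1, d2⟩ := dom_split hd hv hT hdom
  obtain ⟨m, h1, h2, -, h4, h5, h6⟩ := split hd hv (fun u v => (hadj u v).1)
    hS hX1 (hT ▸ hX2) hf d1 d2
  refine ⟨_, _, m, _, _, ⟨_, h1, rfl⟩, ⟨_, h2, rfl⟩, h5, h6, ?_⟩
  intro hm
  obtain ⟨x, hx⟩ := h4 hm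
  refine ⟨x, ?_⟩
  rw [hT]; simp at hx ⊢; tauto

theorem tt_glue {G Gl Gr : TSGraph α} (h : IsTrueTwin G Gl Gr) {a b k nl nr : ℕ}
    (h1 : Gl.Has a nl) (h2 : Gr.Has b nr) (h3 : (a + b + k) % 2 = 0) (h4 : a ≤ b + k)
    (h5 : b ≤ a + k) (h6 : k ≤ a + b) : G.Has k (nl + nr) := by
  obtain ⟨hd, hv, hadj, hT⟩ := h
  obtain ⟨Sl, hSl, rfl⟩ := h1
  obtain ⟨Sr, hSr, rfl⟩ := h2
  obtain ⟨h7, h8⟩ := twin_glue (m := (a + b - k) / 2) hd hv hT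
    (fun u v h => (hadj u v).2 (by simp [h]))
    (fun u v h => (hadj u v).2 (by simp [h])) (fun _ u hu v hv => (hadj u v).2 (by simp [hu, hv]))
    hSl hSr (by omega) (by omega)
  refine ⟨_, ?_, h8⟩
  convert h7 using 1
  omega

theorem tt_hit {G Gl Gr : TSGraph α} (h : IsTrueTwin G Gl Gr) {nl nr : ℕ}
    (h1 : Gl.Has 0 nl) (h2 : Gr.Has 0 nr) (h3 : Gl.Hit nl ∨ Gr.Hit nr) : G.Hit (nl + nr) := by
  obtain ⟨hd, hv, hadj, hT⟩ := h
  obtain ⟨Sl, hSl, hcl, Sr, hSr, hcr, hh⟩ : ∃ Sl, Gl.Adm 0 Sl ∧ Sl.card = nl ∧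
      ∃ Sr, Gr.Adm 0 Sr ∧ Sr.card = nr ∧ ((Sl ∩ Gl.TS).Nonempty ∨ (Sr ∩ Gr.TS).Nonempty) := by
    obtain ⟨Sl, hSl, hcl⟩ := h1
    obtain ⟨Sr, hSr, hcr⟩ := h2
    rcases h3 with ⟨S, a, b, c⟩ | ⟨S, a, b, c⟩
    · exact ⟨S, a, b, Sr, hSr, hcr, Or.inl c⟩
    · exact ⟨Sl, hSl, hcl, S, a, b, Or.inr c⟩
  obtain ⟨h3, h4⟩ := twin_glue (m := 0) hd hv hT (fun u v h => (hadj u v).2 (by simp [h]))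
    (fun u v h => (hadj u v).2 (by simp [h])) (by simp) hSl hSr (by simp) (by simp)
  refine ⟨_, h3, by omega, ?_⟩
  rw [hT]
  rcases hh with ⟨x, hx⟩ | ⟨x, hx⟩ <;> exact ⟨x, by simp at hx ⊢; tauto⟩

theorem at_split {G Gl Gr : TSGraph α} (h : IsAttach G Gl Gr) {S : Finset α} {k : ℕ}
    (hn : G.Adm k S) :
    ∃ m nl nr, Gl.Has (k + m) nl ∧ Gr.Has m nr ∧ S.card = nl + nr ∧
      (k = 0 → (S ∩ G.TS).Nonempty ∨ (m = 0 ∧ Gr.Pds nr)) := by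
  obtain ⟨hd, hv, hadj, hT⟩ := h
  have hd' := Finset.disjoint_left.1 hd
  obtain ⟨hS, hdom, X, hX, rfl, f, hf⟩ := hn
  have hX1 := hX.trans Finset.inter_subset_left
  have hX2 : X ⊆ Gl.TS := hT ▸ hX.trans Finset.inter_subset_right
  have hXr : X ∩ Gr.verts = ∅ := by
    rw [← Finset.disjoint_iff_inter_eq_empty]
    exact hd.mono_left (hX2.trans Gl.TS_sub)
  have hdomr : ∀ v ∈ Gr.verts, v ∈ S ∨ ∃ u ∈ S, G.Adj u v := by
    intro v h1
    refine hdom v (by simp [hv, h1]) ?_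
    rw [hT]; exact fun h => hd' (Gl.TS_sub h) h1
  obtain ⟨m, h1, h2, -, h4, h5, h6⟩ := split hd hv (fun u v => (hadj u v).1)
    hS hX1 (hX2.trans Finset.subset_union_left) hf
    (fun v h1 h2 => hdom v (by simp [hv, h1]) (by rwa [hT])) (fun v h1 _ => hdomr v h1)
  rw [hXr] at h2 h6
  simp only [Finset.card_empty, zero_add, add_zero] at h2 h6
  refine ⟨m, _, _, ⟨_, h6 ▸ h1, rfl⟩, ⟨_, h2, rfl⟩, h5, ?_⟩
  intro hk
  by_cases hne : (S ∩ G.TS).Nonempty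
  · exact Or.inl hne
  right
  rw [hT] at hne
  have hm : m = 0 := by
    by_contra hm
    exact hne (h4 (by omega))
  subst hm
  refine ⟨rfl, _, h2, rfl, ?_⟩
  intro v hvr
  rcases hdomr v hvr with h | ⟨u, hu, h⟩
  · simp [h, hvr]
  right
  have hu' : u ∉ Gl.TS := fun h => hne ⟨u, by simp [hu, h]⟩
  rcases (hadj u v).1 h with h | h | h | h
  · exact absurd hvr (hd' (Gl.adj_mem _ _ h).2)
  · exact ⟨u, by simp [hu, (Gr.adj_mem _ _ h).1], h⟩
  · exact absurd h.1 hu'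
  · exact absurd hvr (hd' (Gl.TS_sub h.2))

/-- Gluing for the attachment operation; `Sl` meets the twin set or `Sr` dominates everything. -/
theorem at_glue_raw {G Gl Gr : TSGraph α} (h : IsAttach G Gl Gr) {k m : ℕ} {Sl Sr : Finset α}
    (hSl : Gl.Adm (k + m) Sl) (hSr : Gr.Adm m Sr)
    (hh : (Sl ∩ Gl.TS).Nonempty ∨ ∀ v ∈ Gr.verts, v ∈ Sr ∨ ∃ u ∈ Sr, Gr.Adj u v) :
    G.Adm k (Sl ∪ Sr) ∧ (Sl ∪ Sr).card = Sl.card + Sr.card := by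
  obtain ⟨hd, hv, hadj, hT⟩ := h
  have hl : ∀ u v, Gl.Adj u v → G.Adj u v := fun u v h => (hadj u v).2 (by simp [h])
  have hr : ∀ u v, Gr.Adj u v → G.Adj u v := fun u v h => (hadj u v).2 (by simp [h])
  obtain ⟨hl1, hl2, Yl, hYl, cYl, fl, hfl⟩ := hSl
  obtain ⟨hr1, hr2, Yr, hYr, cYr, fr, hfr⟩ := hSr
  obtain ⟨Xl, hXl, Xr, hXr, c1, c2, c3, c4, f, hf⟩ :=
    glue (m := m) hd hl hr (fun _ u hu v hv => (hadj u v).2 (by simp [hu, hv]))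
      hl1 hr1 hYl hYr hfl hfr (by omega) (by omega)
  have hXr0 : Xr = ∅ := Finset.card_eq_zero.1 (by omega)
  subst hXr0
  refine ⟨⟨?_, ?_, Xl, ?_, by omega, f, by simpa using hf⟩, c4⟩
  · rw [hv]; exact Finset.union_subset_union hl1 hr1
  · intro v h1 h2
    rw [hv, Finset.mem_union] at h1
    rw [hT] at h2
    simp only [Finset.mem_union]
    rcases h1 with h1 | h1
    · rcases hl2 v h1 h2 with h | ⟨u, hu, h⟩
      · simp [h]
      · exact Or.inr ⟨u, by simp [hu], hl _ _ h⟩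
    · have : (∃ u ∈ Sl, u ∈ Gl.TS ∧ v ∈ Gr.TS) ∨ v ∈ Sr ∨ ∃ u ∈ Sr, Gr.Adj u v := by
        rcases hh with ⟨u, hu⟩ | hh
        · rw [Finset.mem_inter] at hu
          by_cases hvT : v ∈ Gr.TS
          · exact Or.inl ⟨u, hu.1, hu.2, hvT⟩
          · exact Or.inr (hr2 v h1 hvT)
        · exact Or.inr (hh v h1)
      rcases this with ⟨u, a, b, c⟩ | h | ⟨u, a, b⟩
      · exact Or.inr ⟨u, by simp [a], (hadj u v).2 (by simp [b, c])⟩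
      · simp [h]
      · exact Or.inr ⟨u, by simp [a], hr _ _ b⟩
  · intro x hx
    rw [hT]
    grind

theorem Adm.meets {G : TSGraph α} {k : ℕ} {S : Finset α} (h : G.Adm k S) (hk : 0 < k) :
    (S ∩ G.TS).Nonempty := by
  obtain ⟨_, _, X, hX, rfl, _⟩ := h
  exact (Finset.card_pos.1 hk).mono hX

theorem at_glue {G Gl Gr : TSGraph α} (h : IsAttach G Gl Gr) {k m nl nr : ℕ}
    (h1 : Gl.Has (k + m) nl) (h2 : Gr.Has m nr) (h3 : 0 < k + m) :
    G.Has k (nl + nr) ∧ (k = 0 → G.Hit (nl + nr)) := by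
  obtain ⟨Sl, hSl, rfl⟩ := h1
  obtain ⟨Sr, hSr, rfl⟩ := h2
  obtain ⟨a, b⟩ := at_glue_raw h hSl hSr (Or.inl (hSl.meets h3))
  refine ⟨⟨_, a, b⟩, ?_⟩
  rintro rfl
  refine ⟨_, a, b, ?_⟩
  obtain ⟨x, hx⟩ := hSl.meets h3
  refine ⟨x, ?_⟩
  rw [h.2.2.2]; simp at hx ⊢; tauto

theorem at_glue_hit {G Gl Gr : TSGraph α} (h : IsAttach G Gl Gr) {nl nr : ℕ}
    (h1 : Gl.Hit nl) (h2 : Gr.Has 0 nr) : G.Hit (nl + nr) := by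
  obtain ⟨Sl, hSl, rfl, hne⟩ := h1
  obtain ⟨Sr, hSr, rfl⟩ := h2
  obtain ⟨a, b⟩ := at_glue_raw (k := 0) h hSl hSr (Or.inl hne)
  refine ⟨_, a, b, ?_⟩
  obtain ⟨x, hx⟩ := hne
  refine ⟨x, ?_⟩
  rw [h.2.2.2]; simp at hx ⊢; tauto

theorem at_glue_pds {G Gl Gr : TSGraph α} (h : IsAttach G Gl Gr) {nl nr : ℕ}
    (h1 : Gl.Has 0 nl) (h2 : Gr.Pds nr) : G.Has 0 (nl + nr) := by
  obtain ⟨Sl, hSl, rfl⟩ := h1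
  obtain ⟨Sr, hSr, rfl, hd⟩ := h2
  obtain ⟨a, b⟩ := at_glue_raw (k := 0) h hSl hSr (Or.inr hd)
  exact ⟨_, a, b⟩

/-- Distance of `k` to the arithmetic progression `lo, lo + 2, ..., hi`. -/
def dst (lo hi k : ℕ) : ℕ :=
  if k < lo then lo - k else if hi < k then k - hi else (k - lo) % 2

/-- The shape of the sequence `γ_k`. -/
def Shape (G : TSGraph α) (M lo hi : ℕ) : Prop :=
  0 < G.TS.card ∧ lo ≤ hi ∧ hi ≤ G.TS.card ∧ (lo + hi) % 2 = 0 ∧ (M + lo) % 2 = 0 ∧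
  (∀ k n, G.Has k n → M + dst lo hi k ≤ n) ∧
  (∀ k ≤ G.TS.card, ∃ n ≤ M + dst lo hi k, G.Has k n)

theorem lip {G : TSGraph α} (d : ℕ) : ∀ {k n : ℕ}, G.Has k n → ∀ k' ≤ G.TS.card,
    k' ≤ k + d → k ≤ k' + d → ∃ n' ≤ n + d, G.Has k' n' := by
  induction d with
  | zero =>
    intro k n h k' _ h1 h2
    obtain rfl : k' = k := by omega
    exact ⟨n, le_rfl, h⟩
  | succ d ih =>
    intro k n h k' hk h1 h2
    by_cases h3 : k' ≤ k + d ∧ k ≤ k' + d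
    · obtain ⟨n', hn, hh⟩ := ih h k' hk h3.1 h3.2
      exact ⟨n', by omega, hh⟩
    by_cases h4 : k' < k
    · obtain ⟨k0, rfl⟩ : ∃ k0, k = k0 + 1 := ⟨k - 1, by omega⟩
      obtain ⟨n1, hn1, hh1⟩ := h.down
      obtain ⟨n', hn, hh⟩ := ih hh1 k' hk (by omega) (by omega)
      exact ⟨n', by omega, hh⟩
    · obtain ⟨n1, hn1, hh1⟩ := h.up (by omega)
      obtain ⟨n', hn, hh⟩ := ih hh1 k' hk (by omega) (by omega)
      exact ⟨n', by omega, hh⟩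

/-- It suffices to attain the minimum on the progression. -/
theorem Shape.mk' {G : TSGraph α} {M lo hi : ℕ} (h0 : 0 < G.TS.card) (h1 : lo ≤ hi)
    (h2 : hi ≤ G.TS.card) (h3 : (lo + hi) % 2 = 0) (h4 : (M + lo) % 2 = 0)
    (h5 : ∀ k n, G.Has k n → M + dst lo hi k ≤ n)
    (h6 : ∀ k, lo ≤ k → k ≤ hi → (lo + k) % 2 = 0 → ∃ n ≤ M, G.Has k n) :
    G.Shape M lo hi := by
  refine ⟨h0, h1, h2, h3, h4, h5, ?_⟩
  intro k hk
  obtain ⟨j, j1, j2, j3, j4, j5⟩ : ∃ j, lo ≤ j ∧ j ≤ hi ∧ (lo + j) % 2 = 0 ∧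
      k ≤ j + dst lo hi k ∧ j ≤ k + dst lo hi k := by
    unfold dst
    split_ifs with c1 c2
    · exact ⟨lo, by omega⟩
    · exact ⟨hi, by omega⟩
    · exact ⟨k - (k - lo) % 2, by omega⟩
  obtain ⟨n, hn, hh⟩ := h6 j j1 j2 j3
  obtain ⟨n2, hn2, hhk⟩ := lip _ hh k hk j4 j5
  exact ⟨n2, by omega, hhk⟩

/-- Upper bound on the progression. -/
theorem Shape.attain {G : TSGraph α} {M lo hi : ℕ} (h : G.Shape M lo hi) {k : ℕ}
    (h1 : lo ≤ k) (h2 : k ≤ hi) (h3 : (lo + k) % 2 = 0) : ∃ n ≤ M, G.Has k n := by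
  obtain ⟨_, _, a3, _, _, _, a7⟩ := h
  obtain ⟨n, hn, hh⟩ := a7 k (by omega)
  refine ⟨n, ?_, hh⟩
  have : dst lo hi k = 0 := by unfold dst; split_ifs <;> omega
  omega

theorem shape_single {G : TSGraph α} {v : α} (hv : G.verts = {v}) (hts : G.TS = {v})
    (hadj : ∀ u w, ¬ G.Adj u w) : G.Shape 0 0 0 := by
  refine Shape.mk' (by simp [hts]) le_rfl (by simp) rfl rfl ?_ ?_
  · rintro k n ⟨S, ⟨_, _, X, hX, rfl, _⟩, rfl⟩
    have := Finset.card_le_card (hX.trans Finset.inter_subset_left)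
    unfold dst; split_ifs <;> omega
  · intro k _ hk _
    obtain rfl : k = 0 := by omega
    refine ⟨0, le_rfl, ∅, ⟨by simp, ?_, ∅, by simp, rfl, id, ?_⟩, rfl⟩
    · intro w h1 h2; rw [hv] at h1; rw [hts] at h2; exact absurd h1 h2
    · intro w hw; simp at hw

theorem card_TS_union {G Gl Gr : TSGraph α} (hd : Disjoint Gl.verts Gr.verts)
    (hT : G.TS = Gl.TS ∪ Gr.TS) : G.TS.card = Gl.TS.card + Gr.TS.card := by
  rw [hT]; exact Finset.card_union_of_disjoint (hd.mono Gl.TS_sub Gr.TS_sub)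

theorem shape_ft {G Gl Gr : TSGraph α} (h : IsFalseTwin G Gl Gr) {Ml al bl Mr ar br : ℕ}
    (hl : Gl.Shape Ml al bl) (hr : Gr.Shape Mr ar br) :
    G.Shape (Ml + Mr) (al + ar) (bl + br) := by
  have hc := card_TS_union h.1 h.2.2.2
  have hl' := hl
  have hr' := hr
  obtain ⟨l1, l2, l3, l4, l5, l6, l7⟩ := hl
  obtain ⟨r1, r2, r3, r4, r5, r6, r7⟩ := hr
  refine Shape.mk' (by omega) (by omega) (by omega) (by omega) (by omega) ?_ ?_
  · intro k n hn
    obtain ⟨a, b, nl, nr, ha, hb, rfl, rfl⟩ := ft_split h hn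
    have e1 := l6 _ _ ha
    have e2 := r6 _ _ hb
    clear l6 r6 l7 r7
    unfold dst at *
    split_ifs at * <;> omega
  · intro k k1 k2 k3
    obtain ⟨a, a1, a2, a3, b1, b2, b3, b4⟩ : ∃ a, al ≤ a ∧ a ≤ bl ∧ (al + a) % 2 = 0 ∧
        ar ≤ k - a ∧ k - a ≤ br ∧ (ar + (k - a)) % 2 = 0 ∧ a ≤ k := by
      by_cases hk : k ≤ bl + ar
      · exact ⟨k - ar, by omega⟩
      · exact ⟨bl, by omega⟩
    obtain ⟨n1, hn1, hh1⟩ := hl'.attain a1 a2 a3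
    obtain ⟨n2, hn2, hh2⟩ := hr'.attain b1 b2 b3
    refine ⟨n1 + n2, by omega, ?_⟩
    have := ft_glue h hh1 hh2
    rwa [Nat.add_sub_cancel' b4] at this

theorem shape_tt {G Gl Gr : TSGraph α} (h : IsTrueTwin G Gl Gr) {Ml al bl Mr ar br : ℕ}
    (hl : Gl.Shape Ml al bl) (hr : Gr.Shape Mr ar br) :
    ∃ M lo hi, G.Shape M lo hi := by
  have hc := card_TS_union h.1 h.2.2.2
  have hl' := hl
  have hr' := hr
  obtain ⟨l1, l2, l3, l4, l5, l6, l7⟩ := hl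
  obtain ⟨r1, r2, r3, r4, r5, r6, r7⟩ := hr
  obtain ⟨a0, b0, lo, A1, A2, A3, B1, B2, B3, L1, L2, L3, L4, L5⟩ :
      ∃ a0 b0 lo, al ≤ a0 ∧ a0 ≤ bl ∧ (al + a0) % 2 = 0 ∧ ar ≤ b0 ∧ b0 ≤ br ∧
      (ar + b0) % 2 = 0 ∧ a0 ≤ b0 + lo ∧ b0 ≤ a0 + lo ∧ lo ≤ a0 + b0 ∧ (a0 + b0 + lo) % 2 = 0 ∧
      (lo ≤ 1 ∨ lo + br = al ∨ lo + bl = ar) := by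
    by_cases c1 : br < al
    · exact ⟨al, br, al - br, by omega⟩
    by_cases c2 : bl < ar
    · exact ⟨bl, ar, ar - bl, by omega⟩
    by_cases c3 : (al + ar) % 2 = 0
    · by_cases c4 : al ≤ ar
      · exact ⟨ar, ar, 0, by omega⟩
      · exact ⟨al, al, 0, by omega⟩
    · by_cases c4 : al ≤ ar
      · exact ⟨ar - 1, ar, 1, by omega⟩
      · exact ⟨al, al - 1, 1, by omega⟩
  refine ⟨Ml + Mr, lo, bl + br, Shape.mk' (by omega) (by omega) (by omega) (by omega)
    (by omega) ?_ ?_⟩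
  · rintro k n ⟨S, hS, rfl⟩
    obtain ⟨a, b, m, nl, nr, ha, hb, e, rfl, -⟩ := tt_split h hS
    have e1 := l6 _ _ ha
    have e2 := r6 _ _ hb
    clear l6 r6 l7 r7
    rw [e]
    have e3 : dst lo (bl + br) (a + b) ≤ dst al bl (a + m) + dst ar br (b + m) := by
      clear e1 e2 e
      unfold dst
      split_ifs <;> omega
    omega
  · intro k k1 k2 k3
    obtain ⟨a, b, a1, a2, a3, b1, b2, b3, t1, t2, t3, t4⟩ : ∃ a b, al ≤ a ∧ a ≤ bl ∧
        (al + a) % 2 = 0 ∧ ar ≤ b ∧ b ≤ br ∧ (ar + b) % 2 = 0 ∧ (a + b + k) % 2 = 0 ∧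
        a ≤ b + k ∧ b ≤ a + k ∧ k ≤ a + b := by
      by_cases c1 : k ≤ a0 + b0
      · exact ⟨a0, b0, by omega⟩
      by_cases c2 : k ≤ bl + b0
      · exact ⟨k - b0, b0, by omega⟩
      · exact ⟨bl, k - bl, by omega⟩
    obtain ⟨n1, hn1, hh1⟩ := hl'.attain a1 a2 a3
    obtain ⟨n2, hn2, hh2⟩ := hr'.attain b1 b2 b3
    exact ⟨n1 + n2, by omega, tt_glue h hh1 hh2 t1 t2 t3 t4⟩

set_option maxHeartbeats 2000000 in
theorem shape_at {G Gl Gr : TSGraph α} (h : IsAttach G Gl Gr) {Ml al bl Mr ar br : ℕ}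
    (hl : Gl.Shape Ml al bl) (hr : Gr.Shape Mr ar br) :
    ∃ M lo hi, G.Shape M lo hi := by
  have hc : G.TS.card = Gl.TS.card := by rw [h.2.2.2]
  have hl' := hl
  have hr' := hr
  obtain ⟨l1, l2, l3, l4, l5, l6, l7⟩ := hl
  obtain ⟨r1, r2, r3, r4, r5, r6, r7⟩ := hr
  have lower : ∀ k n, G.Has k n → ∃ m,
      Ml + Mr + dst al bl (k + m) + dst ar br m ≤ n := by
    rintro k n ⟨S, hS, rfl⟩
    obtain ⟨m, nl, nr, ha, hb, e, -⟩ := at_split h hS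
    have e1 := l6 _ _ ha
    have e2 := r6 _ _ hb
    exact ⟨m, by omega⟩
  have upper : ∀ k m, k + m ≤ Gl.TS.card → m ≤ Gr.TS.card → 0 < k + m →
      ∃ n ≤ Ml + Mr + dst al bl (k + m) + dst ar br m, G.Has k n := by
    intro k m h1 h2 h3
    obtain ⟨n1, hn1, hh1⟩ := l7 _ h1
    obtain ⟨n2, hn2, hh2⟩ := r7 _ h2
    exact ⟨n1 + n2, by omega, (at_glue h hh1 hh2 h3).1⟩
  clear l6 l7 r6 r7 hl' hr'
  by_cases c1 : bl < ar
  · refine ⟨Ml + Mr + (ar - bl), 0, 0, Shape.mk' (by omega) (by omega) (by omega) (by omega)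
      (by omega) ?_ ?_⟩
    · intro k n hn
      obtain ⟨m, hm⟩ := lower k n hn
      have : ar - bl + dst 0 0 k ≤ dst al bl (k + m) + dst ar br m := by
        clear hm
        unfold dst
        split_ifs <;> omega
      omega
    · intro k _ k2 _
      obtain rfl : k = 0 := by omega
      obtain ⟨n, hn, hh⟩ := upper 0 (max 1 bl) (by omega) (by omega) (by omega)
      refine ⟨n, ?_, hh⟩
      have : dst al bl (0 + max 1 bl) + dst ar br (max 1 bl) ≤ ar - bl := by
        clear hn
        unfold dst
        split_ifs <;> omega
      omega
  obtain ⟨lo, L1, L2, L3⟩ : ∃ lo, lo ≤ bl - ar ∧ (lo + al + ar) % 2 = 0 ∧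
      ((lo ≤ 1 ∧ al ≤ br + lo) ∨ lo + br = al) := by
    by_cases c2 : br < al
    · exact ⟨al - br, by omega⟩
    · exact ⟨(al + ar) % 2, by omega⟩
  have lower' : ∀ k n, G.Has k n → Ml + Mr + dst lo (bl - ar) k ≤ n := by
    intro k n hn
    obtain ⟨m, hm⟩ := lower k n hn
    have : dst lo (bl - ar) k ≤ dst al bl (k + m) + dst ar br m := by
      clear hm
      unfold dst
      split_ifs <;> omega
    omega
  have upper' : ∀ k, 0 < k → lo ≤ k → k ≤ bl - ar → (lo + k) % 2 = 0 →
      ∃ n ≤ Ml + Mr, G.Has k n := by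
    intro k k0 k1 k2 k3
    obtain ⟨n, hn, hh⟩ := upper k (max ar (al - k)) (by omega) (by omega) (by omega)
    refine ⟨n, ?_, hh⟩
    have : dst al bl (k + max ar (al - k)) + dst ar br (max ar (al - k)) = 0 := by
      clear hn
      unfold dst
      split_ifs <;> omega
    omega
  by_cases c2 : 0 < lo
  · exact ⟨Ml + Mr, lo, bl - ar, Shape.mk' (by omega) (by omega) (by omega) (by omega)
      (by omega) lower' (fun k k1 k2 k3 => upper' k (by omega) k1 k2 k3)⟩
  obtain rfl : lo = 0 := by omega
  by_cases c3 : ∃ n ≤ Ml + Mr, G.Has 0 n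
  · refine ⟨Ml + Mr, 0, bl - ar, Shape.mk' (by omega) (by omega) (by omega) (by omega)
      (by omega) lower' ?_⟩
    intro k k1 k2 k3
    by_cases k0 : k = 0
    · subst k0; exact c3
    · exact upper' k (by omega) k1 k2 k3
  push Not at c3
  have zero : ∀ n, G.Has 0 n → Ml + Mr + 2 ≤ n := by
    intro n hn
    have e1 := hn.parity
    by_contra e2
    by_cases e3 : n ≤ Ml + Mr
    · exact c3 n e3 hn
    · omega
  by_cases c4 : 0 < bl - ar
  · refine ⟨Ml + Mr, 2, bl - ar, Shape.mk' (by omega) (by omega) (by omega) (by omega)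
      (by omega) ?_ (fun k k1 k2 k3 => upper' k (by omega) (by omega) k2 (by omega))⟩
    intro k n hn
    by_cases k0 : k = 0
    · subst k0; have := zero n hn; simpa [dst] using this
    · have := lower' k n hn
      unfold dst at *
      split_ifs at * <;> omega
  · have har : ar = 0 := by
      by_contra har
      obtain ⟨n, hn, hh⟩ := upper 0 ar (by omega) (by omega) (by omega)
      refine c3 n ?_ hh
      have : dst al bl (0 + ar) + dst ar br ar = 0 := by
        clear hn
        unfold dst
        split_ifs <;> omega
      omega
    refine ⟨Ml + Mr + 1, 1, 1, Shape.mk' (by omega) (by omega) (by omega) (by omega)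
      (by omega) ?_ ?_⟩
    · intro k n hn
      by_cases k0 : k = 0
      · subst k0; have e := zero n hn; have e2 : dst 1 1 0 = 1 := rfl; omega
      · have := lower' k n hn
        unfold dst at *
        split_ifs at * <;> omega
    · intro k k1 k2 _
      obtain rfl : k = 1 := by omega
      obtain ⟨n, hn, hh⟩ := upper 1 0 (by omega) (by omega) (by omega)
      refine ⟨n, ?_, hh⟩
      have : dst al bl (1 + 0) + dst ar br 0 ≤ 1 := by
        clear hn
        unfold dst
        split_ifs <;> omega
      omega

/-- The inductive property. -/
def HitProp (G : TSGraph α) : Prop :=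
  ∀ n0, G.Has 0 n0 → (∀ n, G.Has 0 n → n0 ≤ n) → ∀ k n, 0 < k → G.Has k n → n ≤ n0 →
    ∃ n' ≤ n0, G.Hit n'

theorem Hit.has {G : TSGraph α} {n : ℕ} (h : G.Hit n) : G.Has 0 n := by
  obtain ⟨S, a, b, _⟩ := h; exact ⟨S, a, b⟩

theorem hit_tw {G Gl Gr : TSGraph α} {nl nr n0 : ℕ}
    (hl : Gl.HitProp) (hr : Gr.HitProp)
    (glue : ∀ a b, Gl.Has 0 a → Gr.Has 0 b → G.Has 0 (a + b))
    (ghit : ∀ a b, Gl.Has 0 a → Gr.Has 0 b → (Gl.Hit a ∨ Gr.Hit b) → G.Hit (a + b))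
    (hnl : Gl.Has 0 nl) (hnr : Gr.Has 0 nr) (e : n0 = nl + nr)
    (hmin : ∀ n, G.Has 0 n → n0 ≤ n) {a b ml mr : ℕ} (hab : 0 < a + b)
    (ha : Gl.Has a ml) (hb : Gr.Has b mr) (hle : ml + mr ≤ n0) : ∃ n' ≤ n0, G.Hit n' := by
  have ml0 : ∀ n, Gl.Has 0 n → nl ≤ n := by
    intro n hn; have := hmin _ (glue _ _ hn hnr); omega
  have mr0 : ∀ n, Gr.Has 0 n → nr ≤ n := by
    intro n hn; have := hmin _ (glue _ _ hnl hn); omega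
  have key : (0 < a ∧ ml ≤ nl) ∨ (0 < b ∧ mr ≤ nr) := by
    by_cases a0 : a = 0
    · subst a0; have := ml0 _ ha; omega
    by_cases b0 : b = 0
    · subst b0; have := mr0 _ hb; omega
    omega
  rcases key with ⟨k1, k2⟩ | ⟨k1, k2⟩
  · obtain ⟨n', hn', hh⟩ := hl nl hnl ml0 a ml k1 ha k2
    exact ⟨n' + nr, by omega, ghit _ _ hh.has hnr (Or.inl hh)⟩
  · obtain ⟨n', hn', hh⟩ := hr nr hnr mr0 b mr k1 hb k2
    exact ⟨nl + n', by omega, ghit _ _ hnl hh.has (Or.inr hh)⟩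

theorem hit_at {G Gl Gr : TSGraph α} (h : IsAttach G Gl Gr) (hl : Gl.HitProp)
    {Mr ar br : ℕ} (hTl : 0 < Gl.TS.card) (hsr : Gr.Shape Mr ar br) : G.HitProp := by
  rintro n0 ⟨S0, hS0, rfl⟩ hmin k n hk ⟨S, hS, rfl⟩ hle
  obtain ⟨m0, nl0, nr0, a1, a2, a3, a4⟩ := at_split h hS0
  rcases a4 rfl with hne | ⟨rfl, hp⟩
  · exact ⟨_, le_rfl, S0, hS0, rfl, hne⟩
  obtain ⟨m, nl, nr, b1, b2, b3, -⟩ := at_split h hS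
  have ml0 : ∀ n, Gl.Has 0 n → nl0 ≤ n := by
    intro n hn; have := hmin _ (at_glue_pds h hn hp); omega
  by_cases c1 : nl ≤ nl0
  · obtain ⟨n', hn', hh⟩ := hl nl0 a1 ml0 (k + m) nl (by omega) b1 c1
    exact ⟨n' + nr0, by omega, at_glue_hit h hh a2⟩
  obtain ⟨Sl, hSl, rfl⟩ := a1
  rcases Has.up_zero hSl with hT | hone
  · refine ⟨Sl.card + nr0, by omega, at_glue_hit h ⟨Sl, hSl, rfl, ?_⟩ a2⟩
    rw [Finset.inter_eq_right.2 hT]; exact Finset.card_pos.1 hTl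
  have key : ∃ n1 < nr0, Gr.Has 1 n1 := by
    by_cases c2 : ∃ n, n < nr0 ∧ Gr.Has 0 n
    · obtain ⟨n', hn', S', hS', rfl⟩ := c2
      have p1 := hS'.parity
      have p2 := a2.parity
      rcases Has.up_zero hS' with hT | hone'
      · exfalso
        have hp' : Gr.Pds S'.card := by
          refine ⟨S', hS', rfl, ?_⟩
          intro v hv
          by_cases hvT : v ∈ Gr.TS
          · exact Or.inl (hT hvT)
          · exact hS'.2.1 v hv hvT
        have := hmin _ (at_glue_pds h ⟨Sl, hSl, rfl⟩ hp')
        omega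
      · exact ⟨_, by omega, hone'⟩
    · push Not at c2
      obtain ⟨r1, r2, r3, r4, r5, r6, r7⟩ := hsr
      obtain ⟨x, hx, hhx⟩ := r7 0 (by omega)
      obtain ⟨y, hy, hhy⟩ := r7 1 (by omega)
      have e1 := r6 _ _ b2
      have e2 : nr0 ≤ x := by
        by_contra hc; exact c2 x (by omega) hhx
      have e3 := r6 _ _ a2
      have e4 : dst ar br 1 < dst ar br 0 := by
        have : 0 < dst ar br 0 := by omega
        clear e1 e2 e3 hx hy
        unfold dst at *
        split_ifs at * <;> omega
      exact ⟨y, by omega, hhy⟩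
  obtain ⟨n1, hn1, hh1⟩ := key
  exact ⟨_, by omega, (at_glue (k := 0) h hone hh1 (by omega)).2 rfl⟩

theorem main_ind {P : TSGraph α → Prop} {G : TSGraph α} (h : FromDecompTree P G) :
    (∃ M lo hi, G.Shape M lo hi) ∧ G.HitProp ∧ P G := by
  induction h with
  | single G v hv hts hadj hP =>
    have hs := shape_single hv hts hadj
    refine ⟨⟨_, _, _, hs⟩, ?_, hP⟩
    intro n0 h0 hmin k n hk hn hle
    obtain ⟨_, _, _, _, _, s6, s7⟩ := hs
    obtain ⟨x, hx, hhx⟩ := s7 0 (by omega)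
    have e1 := hmin x hhx
    have e2 := s6 k n hn
    have e3 : 0 < dst 0 0 k := by unfold dst; split_ifs <;> omega
    have e4 : dst 0 0 0 = 0 := rfl
    omega
  | ttwin G Gl Gr _ _ h hP ihl ihr =>
    obtain ⟨⟨_, _, _, sl⟩, ql, -⟩ := ihl
    obtain ⟨⟨_, _, _, sr⟩, qr, -⟩ := ihr
    refine ⟨shape_tt h sl sr, ?_, hP⟩
    rintro n0 ⟨S0, hS0, e0⟩ hmin k n hk ⟨S, hS, rfl⟩ hle
    obtain ⟨a, b, m, nl, nr, a1, a2, a3, a4, a5⟩ := tt_split h hS0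
    by_cases hm : 0 < m
    · exact ⟨n0, le_rfl, S0, hS0, e0, a5 hm⟩
    obtain rfl : m = 0 := by omega
    obtain rfl : a = 0 := by omega
    obtain rfl : b = 0 := by omega
    obtain ⟨c, d, m', ml, mr, b1, b2, b3, b4, -⟩ := tt_split h hS
    exact hit_tw ql qr (fun a b ha hb => tt_glue h ha hb rfl (by omega) (by omega) (by omega))
      (fun a b => tt_hit h) a1 a2 (by omega) hmin (by omega) b1 b2 (by omega)
  | ftwin G Gl Gr _ _ h hP ihl ihr =>
    obtain ⟨⟨_, _, _, sl⟩, ql, -⟩ := ihl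
    obtain ⟨⟨_, _, _, sr⟩, qr, -⟩ := ihr
    refine ⟨⟨_, _, _, shape_ft h sl sr⟩, ?_, hP⟩
    intro n0 h0 hmin k n hk hn hle
    obtain ⟨a, b, nl, nr, a1, a2, a3, a4⟩ := ft_split h h0
    obtain rfl : a = 0 := by omega
    obtain rfl : b = 0 := by omega
    obtain ⟨c, d, ml, mr, b1, b2, b3, b4⟩ := ft_split h hn
    exact hit_tw ql qr (fun a b ha hb => ft_glue h ha hb)
      (fun a b => ft_hit h) a1 a2 (by omega) hmin (by omega) b1 b2 (by omega)
  | attach G Gl Gr _ _ h hP ihl ihr =>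
    obtain ⟨⟨_, _, _, sl⟩, ql, -⟩ := ihl
    obtain ⟨⟨_, _, _, sr⟩, qr, -⟩ := ihr
    exact ⟨shape_at h sl sr, hit_at h ql sl.1 sr, hP⟩

end TSGraph

open TSGraph in
/-- If `(H, TS(H))` arises from a decomposition tree in which every
occurring twin-set graph has all families `D_k` nonempty, and `β(H) > 0`, then
there exists `D ∈ D_0(H)` with `D ∩ TS(H) ≠ ∅`. -/
theorem stmt19 {α : Type*} [DecidableEq α] (H : TSGraph α)
    (h : FromDecompTree AllDkNonempty H)
    (hbeta : 0 < H.betaVal) :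
    ∃ D, H.memD 0 D ∧ (D ∩ H.TS).Nonempty := by
  obtain ⟨-, hq, hP⟩ := main_ind h
  obtain ⟨D0, hD0, hD0min⟩ := hP 0 (by omega)
  set s := {k | k ≤ H.TS.card ∧ H.gamma k = H.minVal} with hs
  have hne : s.Nonempty := by
    by_contra hc
    rw [Set.not_nonempty_iff_eq_empty] at hc
    have : H.betaVal = sSup s := rfl
    rw [this, hc] at hbeta
    simp at hbeta
  have hbd : BddAbove s := ⟨H.TS.card, fun k hk => hk.1⟩
  obtain ⟨hk1, hk2⟩ : H.betaVal ≤ H.TS.card ∧ H.gamma H.betaVal = H.minVal :=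
    Nat.sSup_mem hne hbd
  obtain ⟨S1, hS1, -⟩ := hP _ hk1
  obtain ⟨S, hS, hSc⟩ : ∃ S, H.Adm H.betaVal S ∧ S.card = H.gamma H.betaVal :=
    Nat.sInf_mem (s := {n | ∃ S, H.Adm H.betaVal S ∧ S.card = n}) ⟨_, S1, hS1, rfl⟩
  have h1 : H.minVal ≤ H.gamma 0 := Nat.sInf_le ⟨0, by omega, rfl⟩
  have h2 : H.gamma 0 ≤ D0.card := Nat.sInf_le ⟨D0, hD0, rfl⟩
  obtain ⟨n', hn', D, hD, rfl, hDT⟩ := hq D0.card ⟨D0, hD0, rfl⟩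
    (by rintro n ⟨S', hS', rfl⟩; exact hD0min S' hS') H.betaVal S.card hbeta ⟨S, hS, rfl⟩
    (by omega)
  exact ⟨D, ⟨hD, fun S' hS' => hn'.trans (hD0min S' hS')⟩, hDT⟩
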